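/- arXiv:1712.08699 — 2 statements merged into one kernel-verified Lean document; each statement's English description precedes it below -/
import Mathlib

section
/- For every finite graph G, one has f(2,G) = 2 if and only if G is online-perfect, i.e., f(w,G) = w for every positive integer w. -/
/-!  Common definitions: the online token-coloring game of Milans–Wigal. -/

/-- Tokens `i` and `j` of the play `s` (Spoiler's `i`-th move is at vertex `s i`) are
adjacent in the token graph: they are distinct tokens lying on the same vertex or on
adjacent vertices of `G`. -/
def TokenAdj {V : Type*} (G : SimpleGraph V) (s : ℕ → V) (i j : ℕ) : Prop :=
  i ≠ j ∧ (s i = s j ∨ G.Adj (s i) (s j))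

/-- The play consisting of the first `n` tokens of `s` is legal for Spoiler in the game of
width `w`: the token graph on these `n` tokens has chromatic number at most `w`. -/
def LegalPlay {V : Type*} (G : SimpleGraph V) (w : ℕ) (s : ℕ → V) (n : ℕ) : Prop :=
  ∃ φ : ℕ → ℕ, (∀ i, i < n → φ i < w) ∧
    ∀ i j, i < n → j < n → TokenAdj G s i j → φ i ≠ φ j

/-- The color that Algorithm's (deterministic, online) strategy `σ` assigns to the `i`-th
token of the play `s`: `σ` is applied to the history of Spoiler's moves up to and
including the `i`-th one. -/
def colorOf {V : Type*} (σ : List V → ℕ) (s : ℕ → V) (i : ℕ) : ℕ :=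
  σ (List.ofFn fun j : Fin (i + 1) => s j)

/-- Strategy `σ` for Algorithm wins the token game on `G` of width `w` using at most `k`
colors: against every legal Spoiler play, all assigned colors lie in `{0, …, k-1}` and the
resulting coloring of the token graph is proper. -/
def AlgWins {V : Type*} (G : SimpleGraph V) (w k : ℕ) (σ : List V → ℕ) : Prop :=
  ∀ (n : ℕ) (s : ℕ → V), LegalPlay G w s n →
    (∀ i, i < n → colorOf σ s i < k) ∧
    ∀ i j, i < n → j < n → TokenAdj G s i j → colorOf σ s i ≠ colorOf σ s j

/-- `gameValue G w` is the value `f(w, G)` of the token game on `G` of width `w`: the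
minimum number of colors with which Algorithm has a winning strategy. -/
noncomputable def gameValue {V : Type*} (G : SimpleGraph V) (w : ℕ) : ℕ :=
  sInf {k | ∃ σ : List V → ℕ, AlgWins G w k σ}

/-- In a Grundy coloring `f` of a finite `P₄`-free graph (given by the relation `R`), every
vertex `v` lies in a clique with `f v + 1` elements. -/
theorem exists_clique_of_grundy {ι : Type*} [Fintype ι] (R : ι → ι → Prop) (f : ι → ℕ)
    (hsymm : ∀ a b, R a b → R b a)
    (hproper : ∀ a b, R a b → f a ≠ f b)
    (hgrundy : ∀ a r, r < f a → ∃ b, R a b ∧ f b = r)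
    (hP4 : ∀ a b c d, R a b → R b c → R c d → R a c ∨ R b d ∨ R a d) (v : ι) :
    ∃ K : Finset ι, v ∈ K ∧ K.card = f v + 1 ∧ ∀ x ∈ K, ∀ y ∈ K, x ≠ y → R x y := by
  classical
  have step : ∀ m, m ≤ f v → ∃ K : Finset ι, v ∈ K ∧ K.card = m + 1 ∧
      (∀ x ∈ K, ∀ y ∈ K, x ≠ y → R x y) ∧ ∀ x ∈ K, f v - m ≤ f x := by
    intro m
    induction m with
    | zero => exact fun _ => ⟨{v}, by simp, by simp, by simp, by simp⟩
    | succ m ih =>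
      intro hm
      obtain ⟨K, hvK, hcard, hK, hlow⟩ := ih (by omega)
      obtain ⟨u₀, -, hu₀⟩ := hgrundy v (f v - (m + 1)) (by omega)
      obtain ⟨u, hu, hmax⟩ := Finset.exists_max_image
        (Finset.univ.filter fun u => f u = f v - (m + 1)) (fun u => (K.filter (R u)).card)
        ⟨u₀, by simpa using hu₀⟩
      simp only [Finset.mem_filter, Finset.mem_univ, true_and] at hu hmax
      have hall : ∀ y ∈ K, R u y := by
        intro y hy
        by_contra huy
        obtain ⟨u', hyu', hu'⟩ := hgrundy y (f v - (m + 1)) (by have := hlow y hy; omega)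
        obtain ⟨x, hxK, hux, hu'x⟩ : ∃ x ∈ K, R u x ∧ ¬ R u' x := by
          by_contra! hcon
          have hlt : (K.filter (R u)).card < (K.filter (R u')).card := by
            apply Finset.card_lt_card
            refine Finset.ssubset_iff_subset_ne.2 ⟨fun x hx => ?_, fun h => ?_⟩
            · rw [Finset.mem_filter] at hx ⊢
              exact ⟨hx.1, hcon x hx.1 hx.2⟩
            · have : y ∈ K.filter (R u') := by simp [hy, hsymm _ _ hyu']
              rw [← h, Finset.mem_filter] at this
              exact huy this.2
          exact absurd (hmax u' hu') (not_le.2 hlt)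
        have hxy : x ≠ y := by rintro rfl; exact huy hux
        rcases hP4 u x y u' hux (hK x hxK y hy hxy) hyu' with h | h | h
        · exact huy h
        · exact hu'x (hsymm _ _ h)
        · exact hproper _ _ h (by omega)
      have huK : u ∉ K := fun h => by have := hlow u h; omega
      refine ⟨insert u K, by simp [hvK], by simp [huK, hcard], ?_, ?_⟩
      · intro x hx y hy hxy
        rcases Finset.mem_insert.1 hx with rfl | hxK <;>
          rcases Finset.mem_insert.1 hy with rfl | hyK
        · exact absurd rfl hxy
        · exact hall y hyK
        · exact hsymm _ _ (hall x hxK)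
        · exact hK x hxK y hyK hxy
      · intro x hx
        rcases Finset.mem_insert.1 hx with rfl | hx
        · omega
        · have := hlow x hx; omega
  obtain ⟨K, hv, hc, hK, -⟩ := step (f v) le_rfl
  exact ⟨K, hv, hc, hK⟩

/-- A two-coloring `c` of the vertices of `G` such that no color class contains an induced
`P₄` and every edge inside a color class is homogeneous to the vertices of the other class. -/
structure IsCographSplit {V : Type*} (G : SimpleGraph V) (c : V → Bool) : Prop where
  homogeneous : ∀ x x' y, G.Adj x x' → c x = c x' → c y ≠ c x → G.Adj x y → G.Adj x' y
  noP4 : ∀ x y z t, c x = c y → c y = c z → c z = c t → G.Adj x y → G.Adj y z → G.Adj z t →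
    G.Adj x z ∨ G.Adj y t ∨ G.Adj x t

/-- The tokens `i` and `j` are adjacent in the token graph and lie in the same class of `c`. -/
def ClassAdj {V : Type*} (G : SimpleGraph V) (c : V → Bool) (s : ℕ → V) (i j : ℕ) : Prop :=
  TokenAdj G s i j ∧ c (s i) = c (s j)

/-- The First-Fit color of the `i`-th token of the play `s` among the tokens in its class. -/
noncomputable def firstFit {V : Type*} (G : SimpleGraph V) (c : V → Bool) (s : ℕ → V) (i : ℕ) :
    ℕ :=
  sInf {r | ∀ j : Fin i, ClassAdj G c s i j → r ≠ firstFit G c s j}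
termination_by i
decreasing_by exact j.2

section FirstFit

variable {V : Type*} {G : SimpleGraph V} {c : V → Bool} {s : ℕ → V}

theorem TokenAdj.symm {i j : ℕ} (h : TokenAdj G s i j) : TokenAdj G s j i :=
  ⟨h.1.symm, h.2.imp Eq.symm fun h => h.symm⟩

theorem ClassAdj.symm {i j : ℕ} (h : ClassAdj G c s i j) : ClassAdj G c s j i :=
  ⟨h.1.symm, h.2.symm⟩

theorem firstFit_ne_of_lt {i j : ℕ} (hji : j < i) (h : ClassAdj G c s i j) :
    firstFit G c s i ≠ firstFit G c s j := by
  have hne : {r | ∀ j : Fin i, ClassAdj G c s i j → r ≠ firstFit G c s j}.Nonempty := by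
    obtain ⟨r, hr⟩ := Infinite.exists_notMem_finset
      (Finset.univ.image fun j : Fin i => firstFit G c s j)
    refine ⟨r, fun j _ h => hr ?_⟩
    rw [h]
    exact Finset.mem_image_of_mem _ (Finset.mem_univ j)
  have := Nat.sInf_mem hne ⟨j, hji⟩ h
  rwa [← firstFit] at this

theorem firstFit_ne {i j : ℕ} (h : ClassAdj G c s i j) :
    firstFit G c s i ≠ firstFit G c s j := by
  rcases lt_or_gt_of_ne h.1.1 with hlt | hlt
  · exact (firstFit_ne_of_lt hlt h.symm).symm
  · exact firstFit_ne_of_lt hlt h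

theorem exists_firstFit_eq {i r : ℕ} (hr : r < firstFit G c s i) :
    ∃ j < i, ClassAdj G c s i j ∧ firstFit G c s j = r := by
  rw [firstFit] at hr
  have := Nat.notMem_of_lt_sInf hr
  simp only [Set.mem_ofPred_eq, not_forall, not_not] at this
  obtain ⟨j, hj, hjr⟩ := this
  exact ⟨j, j.2, hj, hjr.symm⟩

theorem firstFit_congr {t : ℕ → V} {i : ℕ} (h : ∀ j ≤ i, s j = t j) :
    firstFit G c s i = firstFit G c t i := by
  induction i using Nat.strong_induction_on with
  | _ i ih =>
    rw [firstFit, firstFit]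
    congr 1
    ext r
    refine forall_congr' fun j => ?_
    rw [ih j j.2 fun k hk => h k (hk.trans j.2.le)]
    simp only [ClassAdj, TokenAdj, h i le_rfl, h j j.2.le]

theorem ClassAdj.noP4 (hc : IsCographSplit G c) {x y z t : ℕ} (hxy : ClassAdj G c s x y)
    (hyz : ClassAdj G c s y z) (hzt : ClassAdj G c s z t) :
    ClassAdj G c s x z ∨ ClassAdj G c s y t ∨ ClassAdj G c s x t := by
  obtain ⟨⟨hxy, axy⟩, cxy⟩ := hxy
  obtain ⟨⟨hyz, ayz⟩, cyz⟩ := hyz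
  obtain ⟨⟨hzt, azt⟩, czt⟩ := hzt
  by_cases hxz : x = z
  · subst hxz
    exact Or.inr (Or.inr ⟨⟨hzt, azt⟩, czt⟩)
  by_cases hyt : y = t
  · subst hyt
    exact Or.inr (Or.inr ⟨⟨hxy, axy⟩, cxy⟩)
  by_cases hxt : x = t
  · subst hxt
    exact Or.inl ⟨⟨hxz, azt.imp Eq.symm fun h => h.symm⟩, czt.symm⟩
  simp only [ClassAdj, TokenAdj]
  rcases axy with axy | axy
  · rw [axy]; tauto
  rcases ayz with ayz | ayz
  · rw [ayz] at axy cxy; tauto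
  rcases azt with azt | azt
  · rw [← azt, ← cyz]; tauto
  have := hc.noP4 _ _ _ _ cxy cyz czt axy ayz azt
  rw [cxy, cyz, czt]
  tauto

theorem exists_clique_firstFit (hc : IsCographSplit G c) {n i : ℕ} (hi : i < n) :
    ∃ K : Finset ℕ, i ∈ K ∧ K.card = firstFit G c s i + 1 ∧ (∀ x ∈ K, x < n) ∧
      ∀ x ∈ K, ∀ y ∈ K, x ≠ y → ClassAdj G c s x y := by
  obtain ⟨K, hiK, hcard, hK⟩ := exists_clique_of_grundy
    (fun a b : Fin n => ClassAdj G c s a b) (fun a => firstFit G c s a)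
    (fun _ _ h => h.symm) (fun _ _ h => firstFit_ne h)
    (fun a r hr => by
      obtain ⟨j, hj, h⟩ := exists_firstFit_eq hr
      exact ⟨⟨j, hj.trans a.2⟩, h⟩)
    (fun _ _ _ _ => ClassAdj.noP4 hc) ⟨i, hi⟩
  refine ⟨K.map Fin.valEmbedding, ?_, by simpa using hcard, ?_, ?_⟩
  · exact Finset.mem_map.2 ⟨_, hiK, rfl⟩
  · intro x hx
    obtain ⟨a, -, rfl⟩ := Finset.mem_map.1 hx
    exact a.2
  · intro x hx y hy hxy
    obtain ⟨a, ha, rfl⟩ := Finset.mem_map.1 hx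
    obtain ⟨b, hb, rfl⟩ := Finset.mem_map.1 hy
    exact hK a ha b hb fun h => hxy (by rw [h])

theorem LegalPlay.card_le {w n : ℕ} (h : LegalPlay G w s n) {K : Finset ℕ}
    (hn : ∀ x ∈ K, x < n) (hK : ∀ x ∈ K, ∀ y ∈ K, x ≠ y → TokenAdj G s x y) : K.card ≤ w := by
  obtain ⟨φ, hφ, hne⟩ := h
  have : K.card ≤ (Finset.range w).card := by
    refine Finset.card_le_card_of_injOn φ (fun x hx => ?_) fun x hx y hy hxy => ?_
    · simpa using hφ x (hn x hx)
    · by_contra hxy'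
      exact hne x y (hn x hx) (hn y hy) (hK x hx y hy hxy') hxy
  simpa using this

theorem firstFit_lt (hc : IsCographSplit G c) {w n i : ℕ} (h : LegalPlay G w s n) (hi : i < n) :
    firstFit G c s i < w := by
  obtain ⟨K, -, hcard, hn, hK⟩ := exists_clique_firstFit (s := s) hc hi
  have := h.card_le hn fun x hx y hy hxy => (hK x hx y hy hxy).1
  omega

theorem firstFit_add_lt (hc : IsCographSplit G c) {w n i j : ℕ} (h : LegalPlay G w s n)
    (hi : i < n) (hj : j < n) (hij : TokenAdj G s i j) (hne : c (s i) ≠ c (s j)) :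
    firstFit G c s i + firstFit G c s j + 1 < w := by
  classical
  obtain ⟨K, hiK, hKcard, hKn, hK⟩ := exists_clique_firstFit (s := s) hc hi
  obtain ⟨L, hjL, hLcard, hLn, hL⟩ := exists_clique_firstFit (s := s) hc hj
  have hadj : G.Adj (s i) (s j) := hij.2.resolve_left fun h => hne (by rw [h])
  have hKc : ∀ x ∈ K, c (s x) = c (s i) ∧ (s i = s x ∨ G.Adj (s i) (s x)) := by
    intro x hx
    by_cases hxi : i = x
    · subst hxi; simp
    · exact ⟨(hK i hiK x hx hxi).2.symm, (hK i hiK x hx hxi).1.2⟩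
  have hLc : ∀ x ∈ L, c (s x) = c (s j) ∧ (s j = s x ∨ G.Adj (s j) (s x)) := by
    intro x hx
    by_cases hxj : j = x
    · subst hxj; simp
    · exact ⟨(hL j hjL x hx hxj).2.symm, (hL j hjL x hx hxj).1.2⟩
  have hKL : ∀ x ∈ K, ∀ y ∈ L, TokenAdj G s x y := by
    intro x hx y hy
    obtain ⟨hcx, hx'⟩ := hKc x hx
    obtain ⟨hcy, hy'⟩ := hLc y hy
    have hxj : G.Adj (s x) (s j) := by
      rcases hx' with hx' | hx'
      · rwa [← hx']
      · exact hc.homogeneous _ _ _ hx' hcx.symm hne.symm hadj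
    refine ⟨?_, Or.inr ?_⟩
    · rintro rfl
      exact hne (hcx.symm.trans hcy)
    · rcases hy' with hy' | hy'
      · rwa [← hy']
      · exact (hc.homogeneous _ _ _ hy' hcy.symm (by rwa [hcx]) hxj.symm).symm
  have hdisj : Disjoint K L :=
    Finset.disjoint_left.2 fun x hx hx' => (hKL x hx x hx').1 rfl
  have := h.card_le (K := K ∪ L)
    (fun x hx => (Finset.mem_union.1 hx).elim (hKn x) (hLn x)) (by
      intro x hx y hy hxy
      rcases Finset.mem_union.1 hx with hx | hx <;> rcases Finset.mem_union.1 hy with hy | hy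
      · exact (hK x hx y hy hxy).1
      · exact hKL x hx y hy
      · exact (hKL y hy x hx).symm
      · exact (hL x hx y hy hxy).1)
  rw [Finset.card_union_of_disjoint hdisj] at this
  omega

/-- Playing First-Fit from the bottom on one class and from the top on the other class wins
the game of width `w` with `w` colors. -/
theorem IsCographSplit.exists_algWins [Nonempty V] (hc : IsCographSplit G c) (w : ℕ) :
    ∃ σ : List V → ℕ, AlgWins G w w σ := by
  let v₀ : V := Classical.arbitrary V
  let F : (ℕ → V) → ℕ → ℕ := fun s i =>
    if c (s i) = true then firstFit G c s i else w - 1 - firstFit G c s i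
  let σ : List V → ℕ := fun L => F (fun j => L.getD j v₀) (L.length - 1)
  have hσ : ∀ s i, colorOf σ s i = F s i := by
    intro s i
    have hs : ∀ j ≤ i, (List.ofFn fun k : Fin (i + 1) => s k).getD j v₀ = s j := by
      intro j hj
      rw [List.getD_eq_getElem?_getD, List.getElem?_ofFn, dif_pos (Nat.lt_succ_of_le hj)]
      rfl
    simp only [colorOf, σ, F, List.length_ofFn, Nat.add_sub_cancel]
    rw [hs i le_rfl, firstFit_congr hs]
  refine ⟨σ, fun n s h => ⟨fun i hi => ?_, fun i j hi hj hij => ?_⟩⟩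
  · have := firstFit_lt hc h hi
    rw [hσ]
    simp only [F]
    split_ifs <;> omega
  · have h1 := firstFit_lt hc h hi
    have h2 := firstFit_lt hc h hj
    rw [hσ, hσ]
    simp only [F]
    by_cases hcc : c (s i) = c (s j)
    · have := firstFit_ne (c := c) ⟨hij, hcc⟩
      rw [hcc]
      split_ifs <;> omega
    · have := firstFit_add_lt hc h hi hj hij hcc
      cases hi' : c (s i) <;> cases hj' : c (s j) <;> simp_all <;> omega

theorem AlgWins.le [Nonempty V] {w k : ℕ} {σ : List V → ℕ} (h : AlgWins G w k σ) : w ≤ k := by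
  let v₀ : V := Classical.arbitrary V
  obtain ⟨h1, h2⟩ := h w (fun _ => v₀) ⟨id, fun _ h => h, fun _ _ _ _ h => h.1⟩
  have : (Finset.range w).card ≤ (Finset.range k).card := by
    refine Finset.card_le_card_of_injOn (colorOf σ fun _ => v₀) (fun x hx => ?_)
      fun x hx y hy hxy => ?_
    · simpa using h1 x (by simpa using hx)
    · by_contra hne
      exact h2 x y (by simpa using hx) (by simpa using hy) ⟨hne, Or.inl rfl⟩ hxy
  simpa using this

theorem IsCographSplit.gameValue_eq [Nonempty V] (hc : IsCographSplit G c) (w : ℕ) :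
    gameValue G w = w := by
  have hw := hc.exists_algWins w
  refine le_antisymm (Nat.sInf_le hw) ?_
  obtain ⟨σ, hσ⟩ := Nat.sInf_mem (s := {k | ∃ σ : List V → ℕ, AlgWins G w k σ}) ⟨w, hw⟩
  exact hσ.le

end FirstFit

section WidthTwo

variable {V : Type*} {G : SimpleGraph V} {σ : List V → ℕ}

/-- In a walk `p` of positive length `m` whose token graph is bipartite by the parity of the
index, a winning strategy for width two must give the same color to both ends, when these are
played first, if and only if `m` is even. -/
theorem AlgWins.color_ends_eq_iff_even (h : AlgWins G 2 2 σ) (p : ℕ → V) {m : ℕ} (hm : 0 < m)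
    (hadj : ∀ i < m, G.Adj (p i) (p (i + 1)))
    (hpar : ∀ i j, i < j → j ≤ m → p i = p j ∨ G.Adj (p i) (p j) → i % 2 ≠ j % 2) :
    σ [p 0, p m] = σ [p 0] ↔ Even m := by
  let e : ℕ → ℕ := fun i => if i = 0 then 0 else if i = 1 then m else i - 1
  let g : ℕ → ℕ := fun k => if k = 0 then 0 else if k = m then 1 else k + 1
  have he : ∀ i < m + 1, e i ≤ m := by intro i hi; simp only [e]; split_ifs <;> omega
  have hinj : ∀ i j, i < m + 1 → j < m + 1 → i ≠ j → e i ≠ e j := by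
    intro i j hi hj hij; simp only [e]; split_ifs <;> omega
  have hg : ∀ k ≤ m, g k < m + 1 := by intro k hk; simp only [g]; split_ifs <;> omega
  have heg : ∀ k ≤ m, e (g k) = k := by
    intro k hk
    by_cases hk0 : k = 0
    · simp [e, g, hk0]
    by_cases hkm : k = m
    · simp [e, g, hkm, hm.ne']
    · simp [e, g, hk0, hkm]
  have hpar' : ∀ i j, i ≠ j → i ≤ m → j ≤ m → p i = p j ∨ G.Adj (p i) (p j) →
      i % 2 ≠ j % 2 := by
    intro i j hij hi hj ha
    rcases lt_or_gt_of_ne hij with hlt | hlt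
    · exact hpar i j hlt hj ha
    · exact (hpar j i hlt hi (ha.imp Eq.symm fun h => h.symm)).symm
  obtain ⟨hlt, hne⟩ := h (m + 1) (fun i => p (e i)) ⟨fun i => e i % 2,
    fun i _ => Nat.mod_lt _ two_pos, fun i j hi hj hij =>
      hpar' _ _ (hinj i j hi hj hij.1) (he i hi) (he j hj) hij.2⟩
  have hC : ∀ k ≤ m, (colorOf σ (fun i => p (e i)) (g k) = colorOf σ (fun i => p (e i)) 0 ↔
      Even k) := by
    intro k
    induction k with
    | zero => simp [g]
    | succ k ih =>
      intro hk
      have h0 := hlt 0 (by omega)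
      have h1 := hlt (g k) (hg k (by omega))
      have h2 := hlt (g (k + 1)) (hg (k + 1) hk)
      have h3 := hne (g k) (g (k + 1)) (hg k (by omega)) (hg (k + 1) hk) ⟨fun hgk => by
        have := heg k (by omega)
        rw [hgk, heg _ hk] at this
        omega, Or.inr (by
        simp only
        rw [heg k (by omega), heg _ hk]
        exact hadj k (by omega))⟩
      rw [Nat.even_add_one, ← ih (by omega)]
      omega
  have := hC m le_rfl
  have hgm : g m = 1 := by simp only [g]; split_ifs <;> omega
  rw [hgm] at this
  simpa [colorOf, e] using this

theorem AlgWins.gem_free (h : AlgWins G 2 2 σ) {a b c d e : V} (hab : G.Adj a b)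
    (hbc : G.Adj b c) (hcd : G.Adj c d) (hac : ¬ G.Adj a c) (hbd : ¬ G.Adj b d)
    (had : ¬ G.Adj a d) (hea : G.Adj e a) (hed : G.Adj e d) : False := by
  have nac : a ≠ c := by rintro rfl; exact had hcd
  have nbd : b ≠ d := by rintro rfl; exact had hab
  have nad : a ≠ d := by rintro rfl; exact hac hcd.symm
  have h1 := h.color_ends_eq_iff_even
    (fun i => match i with | 0 => a | 1 => b | 2 => c | _ => d) (m := 3) (by norm_num)
    (by intro i hi; interval_cases i <;> assumption)
    (by intro i j hij hj; interval_cases j <;> interval_cases i <;> simp_all)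
  have h2 := h.color_ends_eq_iff_even
    (fun i => match i with | 0 => a | 1 => e | _ => d) (m := 2) (by norm_num)
    (by intro i hi; interval_cases i <;> simp_all [G.adj_comm])
    (by intro i j hij hj; interval_cases j <;> interval_cases i <;> simp_all)
  exact absurd (h1.1 (h2.2 (by decide))) (by decide)

theorem AlgWins.house_free (h : AlgWins G 2 2 σ) {a b c d e : V} (hab : G.Adj a b)
    (hcd : G.Adj c d) (hda : G.Adj d a) (heb : G.Adj e b) (hec : G.Adj e c)
    (hac : ¬ G.Adj a c) (nac : a ≠ c) (hea : ¬ G.Adj e a) (nea : e ≠ a) (hed : ¬ G.Adj e d)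
    (ned : e ≠ d) : False := by
  have h1 := h.color_ends_eq_iff_even
    (fun i => match i with | 0 => a | 1 => d | 2 => c | _ => e) (m := 3) (by norm_num)
    (by intro i hi; interval_cases i <;> simp_all [G.adj_comm])
    (by
      have := nea.symm
      have := ned.symm
      rw [G.adj_comm] at hea hed
      intro i j hij hj; interval_cases j <;> interval_cases i <;> simp_all)
  have h2 := h.color_ends_eq_iff_even
    (fun i => match i with | 0 => a | 1 => b | _ => e) (m := 2) (by norm_num)
    (by intro i hi; interval_cases i <;> simp_all [G.adj_comm])
    (by
      have := nea.symm
      rw [G.adj_comm] at hea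
      intro i j hij hj; interval_cases j <;> interval_cases i <;> simp_all)
  exact absurd (h1.1 (h2.2 (by decide))) (by decide)

/-- After three pairwise nonadjacent vertices are played, a winning strategy for width two has
given the same color to any two of them that have a common neighbor `x`. -/
theorem AlgWins.color_eq_of_common_neighbor (h : AlgWins G 2 2 σ) {a d e x : V}
    (s : ℕ → V) (h0 : s 0 = a) (h1 : s 1 = d) (h2 : s 2 = e) (h3 : s 3 = x)
    (had : ¬ G.Adj a d) (nad : a ≠ d)
    (hae : ¬ G.Adj a e) (nae : a ≠ e) (hde : ¬ G.Adj d e) (nde : d ≠ e) (i j : ℕ) (hi : i < 3)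
    (hj : j < 3) (hix : G.Adj (s i) x) (hjx : G.Adj (s j) x) :
    colorOf σ s i = colorOf σ s j := by
  obtain ⟨hlt, hne⟩ := h 4 s ⟨fun i => if i = 3 then 1 else 0,
    fun i _ => by dsimp only; split_ifs <;> omega, by
      have := nad.symm
      have := nae.symm
      have := nde.symm
      have := fun h => had (G.adj_symm h)
      have := fun h => hae (G.adj_symm h)
      have := fun h => hde (G.adj_symm h)
      rintro i j hi hj ⟨hij, hadj⟩
      interval_cases i <;> interval_cases j <;> simp_all⟩
  have := hlt i (by omega)
  have := hlt j (by omega)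
  have := hlt 3 (by omega)
  have := hne i 3 (by omega) (by omega) ⟨by omega, Or.inr (by rwa [h3])⟩
  have := hne j 3 (by omega) (by omega) ⟨by omega, Or.inr (by rwa [h3])⟩
  omega

theorem colorOf_congr {s t : ℕ → V} {i : ℕ} (h : ∀ j ≤ i, s j = t j) :
    colorOf σ s i = colorOf σ t i := by
  unfold colorOf
  congr 2
  funext j
  exact h j (Nat.lt_succ_iff.1 j.2)

/-- The bull: a triangle `b c e` with pendant vertices `a` at `b` and `d` at `c`. -/
theorem AlgWins.bull_free (h : AlgWins G 2 2 σ) {a b c d e : V} (hab : G.Adj a b)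
    (hbc : G.Adj b c) (hcd : G.Adj c d) (heb : G.Adj e b) (hec : G.Adj e c)
    (hac : ¬ G.Adj a c) (hbd : ¬ G.Adj b d) (had : ¬ G.Adj a d) (hae : ¬ G.Adj a e)
    (hde : ¬ G.Adj d e) : False := by
  have nad : a ≠ d := by rintro rfl; exact hac hcd.symm
  have nae : a ≠ e := by rintro rfl; exact hac hec
  have nde : d ≠ e := by rintro rfl; exact hbd heb.symm
  have nac : a ≠ c := by rintro rfl; exact had hcd
  have nbd : b ≠ d := by rintro rfl; exact had hab
  have key := h.color_ends_eq_iff_even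
    (fun i => match i with | 0 => a | 1 => b | 2 => c | _ => d) (m := 3) (by norm_num)
    (by intro i hi; interval_cases i <;> assumption)
    (by intro i j hij hj; interval_cases j <;> interval_cases i <;> simp_all)
  let S : V → ℕ → V := fun x i => match i with | 0 => a | 1 => d | 2 => e | _ => x
  have e1 := h.color_eq_of_common_neighbor (S b) rfl rfl rfl rfl had nad hae nae hde nde 0 2
    (by norm_num) (by norm_num) hab heb
  have e2 := h.color_eq_of_common_neighbor (S c) rfl rfl rfl rfl had nad hae nae hde nde 1 2
    (by norm_num) (by norm_num) hcd.symm hec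
  have e3 : colorOf σ (S b) 2 = colorOf σ (S c) 2 :=
    colorOf_congr fun j hj => by interval_cases j <;> rfl
  have : colorOf σ (S b) 0 = colorOf σ (S c) 1 := by rw [e1, e3, e2]
  simp [colorOf, S] at this
  exact absurd (key.1 this.symm) (by decide)


theorem exists_parent {s u : V} {d : ℕ} (hd : G.dist s u = d + 1) :
    ∃ y, G.Adj y u ∧ G.dist s y = d := by
  have hr : G.Reachable u s := (SimpleGraph.Reachable.of_dist_ne_zero (by omega)).symm
  obtain ⟨w, hw⟩ := hr.exists_walk_length_eq_dist
  rw [SimpleGraph.dist_comm, hd] at hw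
  cases w with
  | nil => simp at hw
  | @cons _ y _ hadj w =>
    refine ⟨y, hadj.symm, ?_⟩
    have h1 := SimpleGraph.dist_le w
    rw [SimpleGraph.dist_comm] at h1
    have h2 := hadj.diff_dist_adj (u := s)
    simp only [SimpleGraph.Walk.length_cons] at hw
    omega

theorem exists_geodesic (s : V) (d : ℕ) : ∀ u, G.Reachable s u → G.dist s u = d →
    ∃ p : ℕ → V, p 0 = s ∧ p d = u ∧ (∀ i < d, G.Adj (p i) (p (i + 1))) ∧
      ∀ i ≤ d, G.dist s (p i) = i := by
  induction d with
  | zero =>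
    intro u hu hd
    refine ⟨fun _ => s, rfl, hu.dist_eq_zero_iff.1 hd, by simp, by simp⟩
  | succ d ih =>
    intro u hu hd
    obtain ⟨y, hyu, hy⟩ := exists_parent hd
    obtain ⟨p, p0, pd, padj, pdist⟩ := ih y (hu.trans hyu.symm.reachable) hy
    refine ⟨fun i => if i ≤ d then p i else u, by simp [p0], by simp, ?_, ?_⟩
    · intro i hi
      rcases Nat.lt_succ_iff_lt_or_eq.1 hi with hi | rfl
      · simpa [hi.le, Nat.succ_le_of_lt hi] using padj i hi
      · simpa [pd] using hyu
    · intro i hi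
      rcases Nat.le_succ_iff.1 hi with hi | rfl
      · simpa [hi] using pdist i hi
      · simpa using hd

theorem dist_le_of_eq_or_adj {s u v : V} (h : u = v ∨ G.Adj u v) :
    G.dist s v ≤ G.dist s u + 1 := by
  rcases h with rfl | h
  · omega
  · have := h.diff_dist_adj (u := s)
    omega

/-- Adjacent vertices at the same positive distance from `s` have the same parents. -/
theorem AlgWins.adj_parent (h : AlgWins G 2 2 σ) {s x x' y : V} {d : ℕ}
    (hx : G.dist s x = d + 1) (hx' : G.dist s x' = d + 1) (hy : G.dist s y = d)
    (hxx' : G.Adj x x') (hyx : G.Adj y x) : G.Adj y x' := by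
  by_contra hyx'
  have hrx : G.Reachable s x := SimpleGraph.Reachable.of_dist_ne_zero (by omega)
  have geo : ∀ {e : ℕ} {p : ℕ → V}, (∀ i ≤ e, G.dist s (p i) = i) → ∀ i j, i < j → j ≤ e →
      p i = p j ∨ G.Adj (p i) (p j) → j = i + 1 := by
    intro e p hp i j hij hj hadj
    have := dist_le_of_eq_or_adj (s := s) hadj
    rw [hp i (by omega), hp j hj] at this
    omega
  obtain ⟨q, q0, qd, qadj, qdist⟩ := exists_geodesic s (d + 1) x'
    (hrx.trans hxx'.reachable) hx'
  have h1 := h.color_ends_eq_iff_even q (Nat.succ_pos d) qadj fun i j hij hj hadj => by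
    have := geo qdist i j hij hj hadj
    omega
  obtain ⟨p, p0, pd, padj, pdist⟩ := exists_geodesic s d y (hrx.trans hyx.symm.reachable) hy
  let r : ℕ → V := fun i => if i ≤ d then p i else if i = d + 1 then x else x'
  have r0 : r 0 = s := by simp [r, p0]
  have rd : r d = y := by simp [r, pd]
  have rd1 : r (d + 1) = x := by simp [r]
  have rd2 : r (d + 2) = x' := by simp [r]
  have rdist : ∀ i ≤ d + 1, G.dist s (r i) = i := by
    intro i hi
    rcases Nat.le_succ_iff.1 hi with hi | rfl
    · simpa [r, hi] using pdist i hi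
    · simpa [r] using hx
  have h2 := h.color_ends_eq_iff_even r (m := d + 2) (by omega)
    (by
      intro i hi
      rcases Nat.lt_succ_iff_lt_or_eq.1 hi with hi | rfl
      · rcases Nat.lt_succ_iff_lt_or_eq.1 hi with hi | rfl
        · simpa [r, hi.le, Nat.succ_le_of_lt hi] using padj i hi
        · rwa [rd, rd1]
      · rwa [rd1, rd2])
    (by
      intro i j hij hj hadj
      rcases Nat.le_succ_iff.1 hj with hj | rfl
      · have := geo rdist i j hij hj hadj
        omega
      · have hd := dist_le_of_eq_or_adj (s := s) hadj
        change r i = r (d + 2) ∨ G.Adj (r i) (r (d + 2)) at hadj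
        change G.dist s (r (d + 2)) ≤ _ at hd
        rw [rd2, hx', rdist i (by omega)] at hd
        have hid : i ≠ d := by
          rintro rfl
          rw [rd, rd2] at hadj
          rcases hadj with rfl | hadj
          · omega
          · exact hyx' hadj
        have : i = d + 1 := by omega
        omega)
  rw [q0, qd] at h1
  rw [r0, rd2] at h2
  have := h1.symm.trans h2
  rw [Nat.even_add_one, show d + 2 = (d + 1) + 1 from rfl, Nat.even_add_one,
    Nat.even_add_one] at this
  tauto

/-- The set `S` is a module of `G`: no vertex outside of `S` distinguishes two vertices of
`S`. -/
def IsGraphModule (G : SimpleGraph V) (S : Set V) : Prop :=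
  ∀ z ∉ S, ∀ u ∈ S, ∀ u' ∈ S, G.Adj z u → G.Adj z u'

/-- Every bipartition of `Z` into nonempty parts is crossed by an edge. -/
def CutConnected (G : SimpleGraph V) (Z : Set V) : Prop :=
  ∀ T : Set V, (∃ u ∈ Z, u ∈ T) → (∃ u ∈ Z, u ∉ T) → ∃ u ∈ Z, ∃ u' ∈ Z, u ∈ T ∧ u' ∉ T ∧ G.Adj u u'

theorem CutConnected.insert {Z : Set V} (hZ : CutConnected G Z) {z u : V} (hu : u ∈ Z)
    (hzu : G.Adj z u) : CutConnected G (insert z Z) := by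
  rintro T ⟨a, ha, haT⟩ ⟨b, hb, hbT⟩
  by_cases h1 : ∃ u ∈ Z, u ∈ T
  · by_cases h2 : ∃ u ∈ Z, u ∉ T
    · obtain ⟨c, hc, d, hd, h⟩ := hZ T h1 h2
      exact ⟨c, Or.inr hc, d, Or.inr hd, h⟩
    · push Not at h2
      have hz : b = z := hb.resolve_right fun h => hbT (h2 b h)
      subst hz
      exact ⟨u, Or.inr hu, b, Or.inl rfl, h2 u hu, hbT, hzu.symm⟩
  · push Not at h1
    have hz : a = z := ha.resolve_right fun h => h1 a h haT
    subst hz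
    exact ⟨a, Or.inl rfl, u, Or.inr hu, haT, h1 u hu, hzu⟩

theorem cutConnected_insert_of_complete {S : Set V} {x : V} (hS : ∀ u ∈ S, G.Adj x u) :
    CutConnected G (insert x S) := by
  rintro T ⟨a, ha, haT⟩ ⟨b, hb, hbT⟩
  by_cases hx : x ∈ T
  · have hbS : b ∈ S := hb.resolve_left fun h => hbT (h ▸ hx)
    exact ⟨x, Or.inl rfl, b, hb, hx, hbT, hS b hbS⟩
  · have haS : a ∈ S := ha.resolve_left fun h => hx (h ▸ haT)
    exact ⟨a, ha, x, Or.inl rfl, haT, hx, (hS a haS).symm⟩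

/-- If `x` dominates `S ∪ {x'}` and `y` is adjacent to `x` but to nothing in `S ∪ {x'}`, then
`S ∪ {x'}` is contained in a module dominated by `x`. -/
theorem AlgWins.exists_module [Finite V] (h : AlgWins G 2 2 σ) {S : Set V} {x x' y : V}
    (hxx' : G.Adj x x') (hxy : G.Adj x y) (hyx' : ¬ G.Adj y x') (nyx' : y ≠ x')
    (hxS : ∀ u ∈ S, G.Adj x u) (hx'S : ∀ u ∈ S, G.Adj x' u) (hyS : ∀ u ∈ S, ¬ G.Adj y u)
    (hy : y ∉ S) :
    ∃ Z : Set V, insert x' S ⊆ Z ∧ IsGraphModule G Z ∧ ∀ u ∈ Z, G.Adj x u := by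
  obtain ⟨Z, ⟨hSZ, hxZ, hyZ, hyZ', hconn⟩, hmax⟩ := (Set.toFinite {Z : Set V |
    insert x' S ⊆ Z ∧ (∀ u ∈ Z, G.Adj x u) ∧ (∀ u ∈ Z, ¬ G.Adj y u) ∧ y ∉ Z ∧
      CutConnected G Z}).exists_maximal ⟨insert x' S, subset_rfl, by
        rintro u (rfl | hu)
        exacts [hxx', hxS u hu], by
        rintro u (rfl | hu)
        exacts [hyx', hyS u hu], by
        rintro (rfl | hu)
        exacts [nyx' rfl, hy hu], cutConnected_insert_of_complete hx'S⟩
  refine ⟨Z, hSZ, ?_, hxZ⟩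
  intro z hz a ha b hb hza
  by_contra hzb
  obtain ⟨u, hu, u', hu', hzu, hzu', huu'⟩ := hconn {t | G.Adj z t} ⟨a, ha, hza⟩ ⟨b, hb, hzb⟩
  change G.Adj z u at hzu
  change ¬ G.Adj z u' at hzu'
  have nzx : z ≠ x := by rintro rfl; exact hzu' (hxZ u' hu')
  have nzy : z ≠ y := by rintro rfl; exact hyZ u hu hzu
  have nzu' : z ≠ u' := by rintro rfl; exact hz hu'
  have nyu' : y ≠ u' := by rintro rfl; exact hyZ' hu'
  have hxu := hxZ u hu
  have hxu' := hxZ u' hu'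
  have hyu := hyZ u hu
  have hyu' := hyZ u' hu'
  have hxz : G.Adj x z := by
    by_contra hxz
    by_cases hzy : G.Adj z y
    · exact h.house_free (a := z) (b := u) (c := x) (d := y) (e := u') hzu hxy hzy.symm
        huu'.symm hxu'.symm (fun h => hxz h.symm) nzx (fun h => hzu' h.symm) nzu'.symm
        (fun h => hyu' h.symm) nyu'.symm
    · exact h.bull_free (a := z) (b := u) (c := x) (d := y) (e := u') hzu hxu.symm hxy
        huu'.symm hxu'.symm (fun h => hxz h.symm) (fun h => hyu h.symm) hzy hzu' hyu'
  have hyz : ¬ G.Adj y z := fun hyz =>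
    h.gem_free (a := u') (b := u) (c := z) (d := y) (e := x) huu'.symm hzu.symm hyz.symm
      (fun h => hzu' h.symm) (fun h => hyu h.symm) (fun h => hyu' h.symm) hxu' hxy
  refine hz (hmax (y := insert z Z) ⟨hSZ.trans (Set.subset_insert z Z), ?_, ?_, ?_,
    hconn.insert hu hzu⟩ (Set.subset_insert z Z) (Set.mem_insert z Z))
  · rintro t (rfl | ht)
    exacts [hxz, hxZ t ht]
  · rintro t (rfl | ht)
    exacts [hyz, hyZ t ht]
  · rintro (h | h)
    exacts [nzy h.symm, hyZ' h]

theorem AlgWins.exists_split_component [Finite V] (h : AlgWins G 2 2 σ) (s : V) :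
    ∃ c : V → Bool,
      (∀ x x' y, G.Reachable s x → G.Adj x x' → c x = c x' → c y ≠ c x → G.Adj x y →
        G.Adj x' y) ∧
      ∀ x y z t, G.Reachable s x → c x = c y → c y = c z → c z = c t → G.Adj x y → G.Adj y z →
        G.Adj z t → G.Adj x z ∨ G.Adj y t ∨ G.Adj x t := by
  classical
  by_cases hK : ∃ x, x ≠ s ∧ G.Reachable s x
  swap
  · push Not at hK
    have key : ∀ x y, G.Reachable s x → ¬ G.Adj x y := by
      intro x y hx hxy
      have h1 : x = s := by by_contra hne; exact hK x hne hx
      have h2 : y = s := by by_contra hne; exact hK y hne (hx.trans hxy.reachable)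
      exact G.loopless.irrefl s (by rwa [h1, h2] at hxy)
    exact ⟨fun _ => true, fun x x' _ hx hxx' => absurd hxx' (key x x' hx),
      fun x y _ _ hx _ _ _ hxy => absurd hxy (key x y hx)⟩
  obtain ⟨x₀, hx₀, hrx₀⟩ := hK
  obtain ⟨S, ⟨hsS, hSr, ⟨o, hoS, hor⟩, hS⟩, hmax⟩ := (Set.toFinite {S : Set V |
    s ∈ S ∧ (∀ u ∈ S, G.Reachable s u) ∧ (∃ u ∉ S, G.Reachable s u) ∧
      IsGraphModule G S}).exists_maximal ⟨{s}, rfl, by rintro u rfl; exact .refl _,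
        ⟨x₀, hx₀, hrx₀⟩, by rintro z _ u rfl u' rfl h; exact h⟩
  let l : V → ℕ := fun u => if u ∈ S then 0 else G.dist s u
  have lin : ∀ {u}, u ∈ S → l u = 0 := fun hu => if_pos hu
  have lout : ∀ {u}, u ∉ S → l u = G.dist s u := fun hu => if_neg hu
  have hnbr : ∀ {z u}, z ∉ S → u ∈ S → G.Adj z u → G.dist s z = 1 := fun hz hu hzu =>
    SimpleGraph.dist_eq_one_iff_adj.2 (hS _ hz _ hu _ hsS hzu).symm
  have lpos : ∀ {u}, G.Reachable s u → u ∉ S → 0 < l u := fun {u} hr hu => by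
    rw [lout hu]
    exact hr.pos_dist_of_ne fun h => hu (h ▸ hsS)
  have ladj : ∀ {u v}, G.Adj u v → l v = l u ∨ l v = l u + 1 ∨ l u = l v + 1 := by
    intro u v huv
    by_cases hu : u ∈ S <;> by_cases hv : v ∈ S
    · simp [lin hu, lin hv]
    · simp [lin hu, lout hv, hnbr hv hu huv.symm]
    · simp [lin hv, lout hu, hnbr hu hv huv]
    · rw [lout hu, lout hv]
      have h1 := huv.diff_dist_adj (u := s)
      omega
  have lmono : ∀ {u v}, G.Adj u v → decide (Even (l u)) = decide (Even (l v)) →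
      l v = l u := by
    intro u v huv he
    rw [decide_eq_decide] at he
    rcases ladj huv with h | h | h
    · exact h
    · rw [h, Nat.even_add_one] at he; tauto
    · rw [h, Nat.even_add_one] at he; tauto
  refine ⟨fun u => decide (Even (l u)), ?_, ?_⟩
  · intro x x' y hrx hxx' hc hcy hxy
    have hrx' := hrx.trans hxx'.reachable
    have hry := hrx.trans hxy.reachable
    have hlx' : l x' = l x := lmono hxx' hc
    have hly : l y = l x + 1 ∨ l x = l y + 1 := (ladj hxy).resolve_left fun h =>
      hcy (by simp only [h])
    by_cases hx : x ∈ S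
    · have hx' : x' ∈ S := by
        by_contra hx'
        have := lpos hrx' hx'
        rw [hlx', lin hx] at this
        omega
      have hy : y ∉ S := fun hy => by
        rw [lin hx, lin hy] at hly
        omega
      exact (hS y hy x hx x' hx' hxy.symm).symm
    have hx' : x' ∉ S := fun hx' => by
      have := lpos hrx hx
      rw [← hlx', lin hx'] at this
      omega
    rw [lout hx', lout hx] at hlx'
    rw [lout hx] at hly
    rcases hly with hly | hly
    · have hy : y ∉ S := fun hy => by rw [lin hy] at hly; omega
      rw [lout hy] at hly
      by_contra hyx'
      have hyx' : ¬ G.Adj y x' := fun h => hyx' h.symm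
      have hpos := lpos hrx hx
      rw [lout hx] at hpos
      obtain ⟨d, hd⟩ := Nat.exists_eq_succ_of_ne_zero hpos.ne'
      rcases d with _ | d
      · have hsx : G.Adj s x := SimpleGraph.dist_eq_one_iff_adj.1 hd
        have hsx' : G.Adj s x' := SimpleGraph.dist_eq_one_iff_adj.1 (hlx'.trans hd)
        obtain ⟨Z, hSZ, hZ, hxZ⟩ := h.exists_module (S := S) hxx' hxy hyx'
          (by rintro rfl; omega) (fun u hu => hS x hx s hsS u hu hsx.symm)
          (fun u hu => hS x' hx' s hsS u hu hsx'.symm)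
          (fun u hu hyu => by have := hnbr hy hu hyu; omega) hy
        have hZS := hmax (y := Z) ⟨hSZ (Or.inr hsS), fun u hu => hrx.trans (hxZ u hu).reachable,
          ⟨x, fun hx => G.loopless.irrefl x (hxZ x hx), hrx⟩, hZ⟩
          fun u hu => hSZ (Or.inr hu)
        exact hx' (hZS (hSZ (Or.inl rfl)))
      · obtain ⟨p, hpx, hp⟩ := exists_parent hd
        have hpx' := h.adj_parent hd (hlx'.trans hd) hp hxx' hpx
        obtain ⟨q, hqp, hq⟩ := exists_parent hp
        have far : ∀ {u v}, G.dist s u + 1 < G.dist s v → ¬ G.Adj u v := fun huv hadj => by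
          have := hadj.diff_dist_adj (u := s)
          omega
        exact h.bull_free (a := q) (b := p) (c := x) (d := y) (e := x') hqp hpx hxy
          hpx'.symm hxx'.symm (far (by omega)) (far (by omega)) (far (by omega))
          (far (by omega)) hyx'
    · by_cases hy : y ∈ S
      · rw [lin hy] at hly
        have hsx' : G.Adj s x' := SimpleGraph.dist_eq_one_iff_adj.1 (by omega)
        exact hS x' hx' s hsS y hy hsx'.symm
      · rw [lout hy] at hly
        exact (h.adj_parent hly (hlx'.trans hly) rfl hxx' hxy.symm).symm
  · intro x y z t hrx hcy hcz hct hxy hyz hzt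
    have hly := lmono hxy hcy
    have hlz := lmono hyz hcz
    have hlt := lmono hzt hct
    have hry := hrx.trans hxy.reachable
    have hrz := hry.trans hyz.reachable
    have hrt := hrz.trans hzt.reachable
    by_contra! hP
    obtain ⟨hxz, hyt, hxt⟩ := hP
    obtain ⟨e, hex, het⟩ : ∃ e, G.Adj e x ∧ G.Adj e t := by
      by_cases hx : x ∈ S
      · have ht : t ∈ S := by
          by_contra ht
          have := lpos hrt ht
          rw [hlt, hlz, hly, lin hx] at this
          omega
        obtain ⟨w⟩ := hor
        obtain ⟨e, -, he1, he2⟩ := w.exists_boundary_dart S hsS hoS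
        exact ⟨e.snd, hS _ he2 _ he1 _ hx e.adj.symm, hS _ he2 _ he1 _ ht e.adj.symm⟩
      · have hpos := lpos hrx hx
        have hout : ∀ {u}, l u = l x → G.dist s u = l x := fun {u} hu => by
          have : u ∉ S := fun h => by rw [lin h] at hu; omega
          rw [← lout this, hu]
        obtain ⟨d, hd⟩ := Nat.exists_eq_succ_of_ne_zero hpos.ne'
        rw [hd] at hout hly
        have hx1 := hout hd
        have hy1 := hout hly
        have hz1 := hout (hlz.trans hly)
        have ht1 := hout (hlt.trans (hlz.trans hly))
        obtain ⟨p, hpx, hp⟩ := exists_parent hx1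
        have hpy := h.adj_parent hx1 hy1 hp hxy hpx
        have hpz := h.adj_parent hy1 hz1 hp hyz hpy
        exact ⟨p, hpx, h.adj_parent hz1 ht1 hp hzt hpz⟩
    exact h.gem_free hxy hyz hzt hxz hyt hxt hex het

theorem AlgWins.exists_isCographSplit [Finite V] (h : AlgWins G 2 2 σ) :
    ∃ c : V → Bool, IsCographSplit G c := by
  choose c hc1 hc2 using h.exists_split_component
  let r : V → V := fun v => (G.connectedComponentMk v).out
  have hr : ∀ v, G.Reachable (r v) v := fun v =>
    SimpleGraph.ConnectedComponent.exact (Quot.out_eq _)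
  have hadj : ∀ {u v}, G.Adj u v → r v = r u := fun huv => by
    simp only [r, SimpleGraph.ConnectedComponent.connectedComponentMk_eq_of_adj huv]
  refine ⟨fun v => c (r v) v, ⟨?_, ?_⟩⟩
  · intro x x' y hxx' hc hcy hxy
    simp only [hadj hxx', hadj hxy] at hc hcy
    exact hc1 (r x) x x' y (hr x) hxx' hc hcy hxy
  · intro x y z t hy hz ht hxy hyz hzt
    simp only [hadj hzt, hadj hyz, hadj hxy] at hy hz ht
    exact hc2 (r x) x y z t (hr x) hy hz ht hxy hyz hzt

end WidthTwo

/-- For a finite graph `G`, one has `f(2, G) = 2` if and only if `G` is online-perfect,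
i.e. `f(w, G) = w` for every positive integer `w`. -/
theorem gameValue_two_iff_online_perfect {V : Type} [Fintype V] (G : SimpleGraph V) :
    gameValue G 2 = 2 ↔ ∀ w : ℕ, 0 < w → gameValue G w = w := by
  refine ⟨fun h w _ => ?_, fun h => h 2 two_pos⟩
  have hne : {k | ∃ σ : List V → ℕ, AlgWins G 2 k σ}.Nonempty :=
    Nat.nonempty_of_sInf_eq_succ h
  obtain ⟨σ, hσ⟩ := Nat.sInf_mem hne
  change AlgWins G 2 (gameValue G 2) σ at hσ
  rw [h] at hσ
  have : Nonempty V := by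
    by_contra hV
    rw [not_nonempty_iff] at hV
    have : gameValue G 2 ≤ 0 := Nat.sInf_le ⟨σ, fun _ s => isEmptyElim (s 0)⟩
    omega
  obtain ⟨c, hc⟩ := hσ.exists_isCographSplit
  exact hc.gameValue_eq w
end

section
/- If a finite graph G contains no pair of twin vertices and no induced subgraph isomorphic to an odd cycle C_n with n ≥ 5, to C_5^+, to P_5^2, or to the bull graph B, then G is bipartite. -/
/-- `C₅⁺`: the 5-cycle with one added chord, equivalently the complement of the path
`P₅` on 5 vertices. -/
def C5plus : SimpleGraph (Fin 5) := (SimpleGraph.pathGraph 5)ᶜ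

/-- `P₅²`: the square (distance-2 power) of the path on 5 vertices: vertices `0,…,4`,
adjacent iff distinct and at distance at most 2 along the path. -/
def P5sq : SimpleGraph (Fin 5) :=
  SimpleGraph.fromRel (fun i j : Fin 5 => i.val ≤ j.val + 2 ∧ j.val ≤ i.val + 2)

/-- The bull graph: a triangle `0,1,2` with pendant vertices `3` (adjacent to `0`) and
`4` (adjacent to `1`). -/
def bullGraph : SimpleGraph (Fin 5) :=
  SimpleGraph.fromRel (fun i j : Fin 5 =>
    (i = 0 ∧ j = 1) ∨ (i = 1 ∧ j = 2) ∨ (i = 0 ∧ j = 2) ∨ (i = 0 ∧ j = 3) ∨ (i = 1 ∧ j = 4))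

/-- `G` contains an induced copy of one of the forbidden graphs: an odd cycle `Cₙ` with
`n ≥ 5`, the graph `C₅⁺`, the graph `P₅²`, or the bull graph. -/
def HasObstruction {V : Type*} (G : SimpleGraph V) : Prop :=
  (∃ n : ℕ, 5 ≤ n ∧ Odd n ∧ Nonempty (SimpleGraph.cycleGraph n ↪g G)) ∨
    Nonempty (C5plus ↪g G) ∨ Nonempty (P5sq ↪g G) ∨ Nonempty (bullGraph ↪g G)

/-- `S` contains no induced path on four vertices. -/
def P4FreeOn {V : Type*} (G : SimpleGraph V) (S : Set V) : Prop :=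
  ∀ a ∈ S, ∀ b ∈ S, ∀ c ∈ S, ∀ d ∈ S, G.Adj a b → G.Adj b c → G.Adj c d →
    ¬ G.Adj a c → ¬ G.Adj b d → G.Adj a d

/-- `S` splits into two nonempty parts with no edge of `G` between them. -/
def SplitOn {V : Type*} (G : SimpleGraph V) (S : Set V) : Prop :=
  ∃ C ⊆ S, C.Nonempty ∧ (S \ C).Nonempty ∧ ∀ a ∈ C, ∀ b ∈ S \ C, ¬ G.Adj a b

/-- `S` contains two vertices that are twins in the subgraph induced by `S`. -/
def TwinsIn {V : Type*} (G : SimpleGraph V) (S : Set V) : Prop :=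
  ∃ a ∈ S, ∃ b ∈ S, a ≠ b ∧ ∀ x ∈ S, x ≠ a → x ≠ b → (G.Adj a x ↔ G.Adj b x)

section

variable {V : Type*} {G : SimpleGraph V} {S T : Set V}

/-- The connected component of `q` in the subgraph induced by `T`. -/
theorem exists_component_within (G : SimpleGraph V) {q : V} (hq : q ∈ T) :
    ∃ C ⊆ T, q ∈ C ∧ (∀ a ∈ C, ∀ b ∈ T \ C, ¬ G.Adj a b) ∧
      ∀ P : V → Prop, (∃ a ∈ C, P a) → (∃ b ∈ C, ¬ P b) →
        ∃ a ∈ C, ∃ b ∈ C, G.Adj a b ∧ P a ∧ ¬ P b := by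
  let R : V → V → Prop := fun a b => G.Adj a b ∧ b ∈ T
  refine ⟨{c | Relation.ReflTransGen R q c}, ?_, .refl, ?_, ?_⟩
  · rintro c (hc : Relation.ReflTransGen R q c)
    cases hc with
    | refl => exact hq
    | tail _ h => exact h.2
  · rintro a ha b ⟨hb, hbC⟩ hab
    exact hbC (Relation.ReflTransGen.tail ha ⟨hab, hb⟩)
  · rintro P ⟨a, ha, hPa⟩ ⟨b, hb, hPb⟩
    by_contra hne
    have key : ∀ c, Relation.ReflTransGen R q c → (P c ↔ P q) := by
      intro c hc
      induction hc with
      | refl => rfl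
      | @tail c d hc hcd ih =>
        rw [← ih]
        have hd : Relation.ReflTransGen R q d := hc.tail hcd
        constructor
        · intro h
          by_contra h'
          exact hne ⟨d, hd, c, hc, hcd.1.symm, h, h'⟩
        · intro h
          by_contra h'
          exact hne ⟨c, hc, d, hd, hcd.1, h, h'⟩
    exact hPb ((key b hb).2 ((key a ha).1 hPa))

theorem P4FreeOn.mono (h : P4FreeOn G S) (hTS : T ⊆ S) : P4FreeOn G T :=
  fun a ha b hb c hc d hd => h a (hTS ha) b (hTS hb) c (hTS hc) d (hTS hd)

theorem P4FreeOn.compl (h : P4FreeOn G S) : P4FreeOn Gᶜ S := by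
  intro a ha b hb c hc d hd
  have := h b hb d hd a ha c hc
  simp only [SimpleGraph.compl_adj]
  have := G.adj_comm
  grind

/-- If a `P₄`-free set splits, then so does its one-point extension, or the extension splits
in the complement. -/
theorem SplitOn.insert {v : V} (hT : SplitOn G T) (hv : v ∉ T)
    (hP : P4FreeOn G (insert v T)) :
    SplitOn G (insert v T) ∨ SplitOn Gᶜ (insert v T) := by
  obtain ⟨A, hAT, ⟨a, ha⟩, ⟨b, hb⟩, hAB⟩ := hT
  by_cases hall : ∀ q ∈ T, G.Adj v q
  · right
    refine ⟨{v}, by simp, by simp, ⟨a, by grind⟩, ?_⟩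
    intro x hx y hy
    simp only [SimpleGraph.compl_adj]
    grind
  · left
    push Not at hall
    obtain ⟨q, hq, hvq⟩ := hall
    obtain ⟨C, hCT, hqC, hcl, hconn⟩ := exists_component_within G hq
    by_cases h1 : ∀ p ∈ C, ¬ G.Adj v p
    · refine ⟨C, by grind, ⟨q, hqC⟩, ⟨v, by grind⟩, ?_⟩
      intro x hx y hy
      have := G.adj_comm x y
      grind
    push Not at h1
    obtain ⟨p, hp, hvp⟩ := h1
    obtain ⟨p, hp, q', hq', hpq, hvp, hvq'⟩ :=
      hconn (fun y => G.Adj v y) ⟨p, hp, hvp⟩ ⟨q, hqC, hvq⟩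
    have hne : (T \ C).Nonempty := by
      by_contra hemp
      have hTC : T ⊆ C := by
        intro x hx
        by_contra hxC
        exact hemp ⟨x, hx, hxC⟩
      obtain ⟨x, hx, y, hy, hxy, hxA, hyA⟩ :=
        hconn (fun y => y ∈ A) ⟨a, hTC (hAT ha), ha⟩ ⟨b, hTC hb.1, hb.2⟩
      exact hAB x hxA y ⟨hCT hy, hyA⟩ hxy
    by_cases h2 : ∃ r ∈ T \ C, G.Adj v r
    · exfalso
      obtain ⟨r, hr, hvr⟩ := h2
      have h3 := hcl p hp r hr
      have h4 := hcl q' hq' r hr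
      exact h4 (hP r (by grind) v (by grind) p (by grind) q' (by grind) hvr.symm hvp hpq
        (fun h => h3 h.symm) hvq').symm
    · push Not at h2
      obtain ⟨r, hr⟩ := hne
      refine ⟨T \ C, by grind, ⟨r, hr⟩, ⟨v, by grind⟩, ?_⟩
      intro x hx y hy
      have := G.adj_comm x y
      grind

/-- Seinsche's theorem: a `P₄`-free graph is disconnected or has disconnected complement. -/
theorem P4FreeOn.split (hfin : S.Finite) (hP : P4FreeOn G S) (hS : S.Nontrivial) :
    SplitOn G S ∨ SplitOn Gᶜ S := by
  induction S, hfin using Set.Finite.induction_on with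
  | empty => simp at hS
  | @insert v T hv _ ih =>
    by_cases hT : T.Nontrivial
    · rcases ih (hP.mono (by simp)) hT with h | h
      · exact h.insert hv hP
      · have := h.insert hv hP.compl
        rw [compl_compl] at this
        exact this.symm
    · rw [Set.not_nontrivial_iff] at hT
      obtain ⟨t, ht⟩ : ∃ t, t ∈ T := by
        obtain ⟨x, hx, y, hy, hxy⟩ := hS
        grind
      have hTt : ∀ x ∈ T, x = t := fun x hx => hT hx ht
      by_cases hvt : G.Adj v t
      · right
        refine ⟨{v}, by simp, by simp, ⟨t, by grind⟩, ?_⟩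
        intro x hx y hy
        simp only [SimpleGraph.compl_adj]
        grind
      · left
        refine ⟨{v}, by simp, by simp, ⟨t, by grind⟩, ?_⟩
        grind

theorem TwinsIn.compl (h : TwinsIn G S) : TwinsIn Gᶜ S := by
  obtain ⟨a, ha, b, hb, hab, h⟩ := h
  refine ⟨a, ha, b, hb, hab, fun x hx hxa hxb => ?_⟩
  simp [SimpleGraph.compl_adj, h x hx hxa hxb, hxa.symm, hxb.symm]

theorem SplitOn.twinsIn (h : SplitOn G S)
    (ih : ∀ T : Set V, T ⊂ S → T.Nontrivial → TwinsIn G T) : TwinsIn G S := by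
  obtain ⟨A, hA, ⟨a, ha⟩, ⟨b, hb⟩, hAB⟩ := h
  by_cases h1 : A.Nontrivial
  · obtain ⟨x, hx, y, hy, hxy, h⟩ := ih A (by rw [Set.ssubset_def]; grind) h1
    refine ⟨x, hA hx, y, hA hy, hxy, fun z hz hzx hzy => ?_⟩
    by_cases hzA : z ∈ A
    · exact h z hzA hzx hzy
    · have := hAB x hx z ⟨hz, hzA⟩
      have := hAB y hy z ⟨hz, hzA⟩
      tauto
  by_cases h2 : (S \ A).Nontrivial
  · obtain ⟨x, hx, y, hy, hxy, h⟩ := ih (S \ A) (by rw [Set.ssubset_def]; grind) h2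
    refine ⟨x, hx.1, y, hy.1, hxy, fun z hz hzx hzy => ?_⟩
    by_cases hzA : z ∈ A
    · have := hAB z hzA x hx
      have := hAB z hzA y hy
      rw [G.adj_comm x, G.adj_comm y]
      tauto
    · exact h z ⟨hz, hzA⟩ hzx hzy
  rw [Set.not_nontrivial_iff] at h1 h2
  refine ⟨a, hA ha, b, hb.1, by grind, fun z hz hza hzb => ?_⟩
  by_cases hzA : z ∈ A
  · exact absurd (h1 hzA ha) hza
  · exact absurd (h2 ⟨hz, hzA⟩ hb) hzb

/-- A finite nontrivial `P₄`-free graph has a pair of twins. -/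
theorem P4FreeOn.twinsIn (hfin : S.Finite) (hP : P4FreeOn G S) (hS : S.Nontrivial) :
    TwinsIn G S := by
  induction h : S.ncard using Nat.strong_induction_on generalizing S with
  | _ n ih =>
    have ih' : ∀ T : Set V, T ⊂ S → T.Nontrivial → TwinsIn G T := fun T hTS hT =>
      ih T.ncard (h ▸ Set.ncard_lt_ncard hTS hfin) (hfin.subset hTS.subset) (hP.mono hTS.subset)
        hT rfl
    rcases hP.split hfin hS with h | h
    · exact h.twinsIn ih'
    · simpa using (h.twinsIn fun T hTS hT => (ih' T hTS hT).compl).compl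

/-- A map whose adjacency pattern is that of a graph without false twins is an embedding. -/
theorem nonempty_embedding_of_adj_iff {W : Type*} {H : SimpleGraph W}
    (hH : ∀ i j, (∀ k, H.Adj i k ↔ H.Adj j k) → i = j) (f : W → V)
    (hf : ∀ i j, G.Adj (f i) (f j) ↔ H.Adj i j) : Nonempty (H ↪g G) := by
  refine ⟨⟨⟨f, fun i j hij => hH i j fun k => ?_⟩, fun {i j} => hf i j⟩⟩
  rw [← hf, ← hf, hij]

theorem gem_obstruction {c w x y z : V} (hcw : G.Adj c w) (hcx : G.Adj c x) (hcy : G.Adj c y)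
    (hcz : G.Adj c z) (hwx : G.Adj w x) (hxy : G.Adj x y) (hyz : G.Adj y z)
    (hwy : ¬ G.Adj w y) (hxz : ¬ G.Adj x z) (hwz : ¬ G.Adj w z) : HasObstruction G := by
  refine .inr (.inr (.inl (nonempty_embedding_of_adj_iff ?_ ![w, x, c, y, z] ?_)))
  · simp only [P5sq, SimpleGraph.fromRel_adj]
    decide
  · intro i j
    have := G.adj_comm
    fin_cases i <;> fin_cases j <;> simp [P5sq, *]

theorem house_obstruction {r u v x y : V} (hru : G.Adj r u) (hrv : G.Adj r v) (huv : G.Adj u v)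
    (hux : G.Adj u x) (hvy : G.Adj v y) (hxy : G.Adj x y)
    (hrx : ¬ G.Adj r x) (hry : ¬ G.Adj r y) (huy : ¬ G.Adj u y) (hvx : ¬ G.Adj v x) :
    HasObstruction G := by
  refine .inr (.inl (nonempty_embedding_of_adj_iff ?_ ![u, y, r, x, v] ?_))
  · simp only [C5plus, SimpleGraph.compl_adj, SimpleGraph.pathGraph_adj]
    decide
  · intro i j
    have := G.adj_comm
    fin_cases i <;> fin_cases j <;> simp [C5plus, SimpleGraph.pathGraph_adj, *]

set_option synthInstance.maxSize 1024 in
theorem bull_obstruction {u v w x y : V} (huv : G.Adj u v) (hvw : G.Adj v w) (huw : G.Adj u w)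
    (hux : G.Adj u x) (hvy : G.Adj v y) (hxy : ¬ G.Adj x y)
    (huy : ¬ G.Adj u y) (hvx : ¬ G.Adj v x) (hwx : ¬ G.Adj w x) (hwy : ¬ G.Adj w y) :
    HasObstruction G := by
  refine .inr (.inr (.inr (nonempty_embedding_of_adj_iff ?_ ![u, v, w, x, y] ?_)))
  · simp only [bullGraph, SimpleGraph.fromRel_adj]
    decide
  · intro i j
    have := G.adj_comm
    fin_cases i <;> fin_cases j <;> simp [bullGraph, *]

theorem P4FreeOn.of_subset_neighborSet {u : V} (hobs : ¬ HasObstruction G)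
    (hS : ∀ s ∈ S, G.Adj u s) : P4FreeOn G S := by
  intro a ha b hb c hc d hd hab hbc hcd hac hbd
  by_contra had
  exact hobs (gem_obstruction (hS a ha) (hS b hb) (hS c hc) (hS d hd) hab hbc hcd hac hbd had)

/-- If no outside vertex separates the ends of an edge inside a set `T` of neighbors of `u`, then
each component of `T` is a homogeneous `P₄`-free set, so an edge inside `T` yields twins. -/
theorem exists_twins_of_edges_homogeneous [Finite V] {u v w : V} (hobs : ¬ HasObstruction G)
    (hT : ∀ t ∈ T, G.Adj u t) (hv : v ∈ T) (hw : w ∈ T) (hvw : G.Adj v w)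
    (hsep : ∀ p ∈ T, ∀ q ∈ T, ∀ z, z ∉ T → G.Adj p q → G.Adj z p → G.Adj z q) :
    ∃ a b : V, a ≠ b ∧ ∀ x : V, x ≠ a → x ≠ b → (G.Adj a x ↔ G.Adj b x) := by
  obtain ⟨C, hCT, hvC, hcl, hconn⟩ := exists_component_within G hv
  have hwC : w ∈ C := by
    by_contra h
    exact hcl v hvC w ⟨hw, h⟩ hvw
  have hP : P4FreeOn G C := .of_subset_neighborSet hobs fun s hs => hT s (hCT hs)
  obtain ⟨a, ha, b, hb, hab, h⟩ := hP.twinsIn C.toFinite ⟨v, hvC, w, hwC, hvw.ne⟩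
  have key : ∀ x, x ∉ C → ∀ a ∈ C, ∀ b ∈ C, G.Adj x a → G.Adj x b := by
    intro x hx a ha b hb hxa
    by_contra hxb
    obtain ⟨p, hp, q, hq, hpq, hxp, hxq⟩ := hconn (G.Adj x) ⟨a, ha, hxa⟩ ⟨b, hb, hxb⟩
    by_cases hxT : x ∈ T
    · exact hcl p hp x ⟨hxT, hx⟩ hxp.symm
    · exact hxq (hsep p (hCT hp) q (hCT hq) x hxT hpq hxp)
  refine ⟨a, b, hab, fun x hxa hxb => ?_⟩
  by_cases hx : x ∈ C
  · exact h x hx hxa hxb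
  · rw [G.adj_comm a, G.adj_comm b]
    exact ⟨key x hx a ha b hb, key x hx b hb a ha⟩

theorem exists_twins_of_triangle [Finite V] {u v w : V} (hobs : ¬ HasObstruction G)
    (huv : G.Adj u v) (huw : G.Adj u w) (hvw : G.Adj v w) :
    ∃ a b : V, a ≠ b ∧ ∀ x : V, x ≠ a → x ≠ b → (G.Adj a x ↔ G.Adj b x) := by
  have adj_comm := G.adj_comm
  by_cases hpaw : ∃ u v w x : V, G.Adj u v ∧ G.Adj u w ∧ G.Adj v w ∧ G.Adj u x ∧
      ¬ G.Adj v x ∧ ¬ G.Adj w x ∧ x ≠ v ∧ x ≠ w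
  · obtain ⟨u, v, w, x, huv, huw, hvw, hux, hvx, hwx, hxv, hxw⟩ := hpaw
    refine exists_twins_of_edges_homogeneous (T := {t | G.Adj u t ∧ ¬ G.Adj t x ∧ t ≠ x}) hobs
      (fun t ht => ht.1) ⟨huv, hvx, hxv.symm⟩ ⟨huw, hwx, hxw.symm⟩ hvw ?_
    rintro p ⟨hup, hpx, hxp⟩ q ⟨huq, hqx, hxq⟩ y hyT hpq hyp
    by_contra hyq
    have hyT' : G.Adj u y → ¬ G.Adj y x → y = x := by
      intro h1 h2
      by_contra h3
      exact hyT ⟨h1, h2, h3⟩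
    have hyx : y ≠ x := by grind
    by_cases huy : G.Adj u y
    · have hyx' : G.Adj y x := by grind
      exact hobs (gem_obstruction huq hup huy hux hpq.symm hyp.symm hyx'
        (by grind) hpx hqx)
    · by_cases hxy : G.Adj x y
      · exact hobs (house_obstruction huq.symm hpq.symm hup hux hyp.symm hxy hqx
          (by grind) huy hpx)
      · exact hobs (bull_obstruction hup hpq huq hux hyp.symm hxy huy hpx hqx (by grind))
  · refine exists_twins_of_edges_homogeneous (T := {t | G.Adj u t}) hobs (fun t ht => ht)
      huv huw hvw ?_
    rintro p hup q huq z hz hpq hzp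
    by_contra hzq
    push Not at hpaw
    have h1 := hpaw p u q z hup.symm hpq huq hzp.symm hz
    by_cases hzu : z = u
    · exact hzq (hzu ▸ huq)
    · exact hz (h1 (fun h => hzq h.symm) hzu ▸ huq)

theorem exists_walk_of_adj_succ {f : ℕ → V} {n : ℕ} (hf : ∀ i < n, G.Adj (f i) (f (i + 1)))
    {i : ℕ} (d : ℕ) (hd : i + d ≤ n) : ∃ w : G.Walk (f i) (f (i + d)), w.length = d := by
  induction d with
  | zero => exact ⟨.nil, rfl⟩
  | succ d ih =>
    obtain ⟨w, hw⟩ := ih (by lia)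
    exact ⟨w.concat (hf (i + d) (by lia)), by simp [hw]⟩

/-- A shortest odd closed walk traverses an induced cycle. -/
theorem exists_odd_cycleGraph_embedding (hG : ¬ G.Colorable 2) :
    ∃ n : ℕ, 3 ≤ n ∧ Odd n ∧ Nonempty (SimpleGraph.cycleGraph n ↪g G) := by
  have hex : ∃ n, Odd n ∧ ∃ u, ∃ w : G.Walk u u, w.length = n := by
    rw [SimpleGraph.two_colorable_iff_forall_loop_even] at hG
    push Not at hG
    obtain ⟨u, w, hw⟩ := hG
    exact ⟨_, by simpa using hw, u, w, rfl⟩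
  classical
  obtain ⟨hodd, u, w, hw⟩ := Nat.find_spec hex
  have hmin : ∀ v (p : G.Walk v v), Odd p.length → Nat.find hex ≤ p.length :=
    fun v p hp => Nat.find_min' hex ⟨hp, v, p, rfl⟩
  generalize Nat.find hex = n at *
  let f := w.getVert
  have hf : ∀ i < n, G.Adj (f i) (f (i + 1)) := fun i hi => w.adj_getVert_succ (hw ▸ hi)
  have hf0 : f 0 = u := w.getVert_zero
  have hfn : f n = u := hw ▸ w.getVert_length
  have hn : 3 ≤ n := by
    by_contra hn
    obtain rfl : n = 1 := by grind
    have := hf 0 (by lia)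
    rw [zero_add, hf0, hfn] at this
    exact this.ne rfl
  have hwalk : ∀ i j, i < j → j < n → (∃ p : G.Walk (f i) (f j), p.length = j - i) ∧
      ∃ p : G.Walk (f j) (f i), p.length = n - (j - i) := by
    intro i j hij hj
    obtain ⟨p, hp⟩ := exists_walk_of_adj_succ hf (i := i) (j - i) (by lia)
    obtain ⟨q, hq⟩ := exists_walk_of_adj_succ hf (i := 0) i (by lia)
    obtain ⟨r, hr⟩ := exists_walk_of_adj_succ hf (i := j) (n - j) (by lia)
    have h1 : i + (j - i) = j := by lia
    have h2 : j + (n - j) = n := by lia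
    refine ⟨⟨p.copy rfl (by rw [h1]), by simpa using hp⟩,
      ⟨(r.copy rfl (by rw [h2, hfn, hf0])).append (q.copy rfl (by rw [zero_add])), ?_⟩⟩
    simp only [SimpleGraph.Walk.length_append, SimpleGraph.Walk.length_copy, hq, hr]
    lia
  have hne : ∀ i j, i < j → j < n → f i ≠ f j := by
    intro i j hij hj heq
    obtain ⟨⟨p, hp⟩, ⟨q, hq⟩⟩ := hwalk i j hij hj
    have hp' := hmin _ (p.copy rfl heq.symm)
    have hq' := hmin _ (q.copy rfl heq)
    rw [SimpleGraph.Walk.length_copy] at hp' hq'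
    grind
  have hadj : ∀ i j, i < j → j < n → (G.Adj (f i) (f j) ↔ j - i = 1 ∨ j - i = n - 1) := by
    intro i j hij hj
    constructor
    · intro h
      obtain ⟨⟨p, hp⟩, ⟨q, hq⟩⟩ := hwalk i j hij hj
      have hp' := hmin _ (p.concat h.symm)
      have hq' := hmin _ (q.concat h)
      rw [SimpleGraph.Walk.length_concat] at hp' hq'
      grind
    · rintro (h | h)
      · obtain rfl : j = i + 1 := by lia
        exact hf i (by lia)
      · obtain rfl : i = 0 := by lia
        have := hf j hj
        rw [show j + 1 = n by lia, hfn, ← hf0] at this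
        exact this.symm
  have hcycle : ∀ i j : Fin n, i < j →
      ((SimpleGraph.cycleGraph n).Adj i j ↔ j.val - i.val = 1 ∨ j.val - i.val = n - 1) := by
    intro i j hij
    rw [SimpleGraph.cycleGraph_adj', Fin.coe_sub_iff_le.2 hij.le, Fin.coe_sub_iff_lt.2 hij]
    lia
  refine ⟨n, hn, hodd, ⟨⟨⟨fun i => f i, fun i j hij => ?_⟩, fun {i j} => ?_⟩⟩⟩
  · rcases lt_trichotomy i j with h | h | h
    · exact absurd hij (hne i j h j.2)
    · exact h
    · exact absurd hij.symm (hne j i h i.2)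
  · change G.Adj (f i) (f j) ↔ _
    rcases lt_trichotomy i j with h | rfl | h
    · rw [hadj i j h j.2, hcycle i j h]
    · simp
    · rw [G.adj_comm, SimpleGraph.adj_comm _ i j, hadj j i h i.2, hcycle j i h]

end

/-- If a finite graph `G` has no pair of twin vertices (distinct vertices with exactly the
same neighbors among the remaining vertices) and contains no induced odd cycle `Cₙ` with
`n ≥ 5`, no induced `C₅⁺`, no induced `P₅²`, and no induced bull, then `G` is
bipartite. -/
theorem twinFree_no_obstruction_bipartite {V : Type} [Fintype V] (G : SimpleGraph V)
    (htwin : ¬ ∃ a b : V, a ≠ b ∧ ∀ x : V, x ≠ a → x ≠ b → (G.Adj a x ↔ G.Adj b x))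
    (hobs : ¬ HasObstruction G) :
    G.Colorable 2 := by
  by_contra hG
  obtain ⟨n, hn, hodd, ⟨f⟩⟩ := exists_odd_cycleGraph_embedding hG
  by_cases h5 : 5 ≤ n
  · exact hobs (.inl ⟨n, h5, hodd, ⟨f⟩⟩)
  obtain rfl : n = 3 := by grind
  have hadj : ∀ i j : Fin 3, i ≠ j → G.Adj (f i) (f j) := by
    intro i j hij
    rw [f.map_adj_iff, SimpleGraph.cycleGraph_adj']
    decide +revert
  exact htwin (exists_twins_of_triangle hobs (hadj 0 1 (by decide)) (hadj 0 2 (by decide))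
    (hadj 1 2 (by decide)))
end
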